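/- Let u ≥ 2 and let F be a fixed nice u-graph with r = v(F) ≥ 4 vertices, and fix g = g(n) with g(n) → ∞ and g(n) = o(log n/log log n). Set π_± = (aut(F)/r!)·(log n ± g(n))/binom(n−1,r−1). Then: (a) for any sequence π(n) ∈ [0,1] with π(n) ≤ π_− for all large n, the probability that the random F-graph H_F(n,π(n)) has an isolated vertex tends to 1 as n → ∞; and (b) for any sequence π(n) ∈ [0,1] with π(n) ≥ π_+ for all large n, the probability that H_F(n,π(n)) has an isolated vertex tends to 0 as n → ∞. -/

import Mathlib

open Classical Filter Asymptotics MeasureTheory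
open scoped ENNReal

noncomputable section

/-- The type of potential `F`-edges on vertex set `Fin n`: a pair consisting of the
`r`-element vertex set of the copy and the `u`-edge set of the copy. -/
abbrev FE (n : ℕ) := Finset (Fin n) × Finset (Finset (Fin n))

/-- `F` (a `u`-graph on `Fin r`) is strictly 1-balanced: every proper subgraph `(V', E')`
with more than one vertex has strictly smaller 1-density, i.e.
`e'/(v'-1) < e(F)/(r-1)`, written multiplicatively. -/
def StrictlyOneBalanced {r : ℕ} (F : Finset (Finset (Fin r))) : Prop :=
  ∀ (V' : Finset (Fin r)) (E' : Finset (Finset (Fin r))),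
    E' ⊆ F → (∀ e ∈ E', e ⊆ V') → 1 < V'.card → ¬(V' = Finset.univ ∧ E' = F) →
      E'.card * (r - 1) < F.card * (V'.card - 1)

/-- After deleting the vertices in `S`, the hypergraph `F` is connected. -/
def ConnectedAvoiding {r : ℕ} (F : Finset (Finset (Fin r))) (S : Finset (Fin r)) : Prop :=
  ∀ x y : Fin r, x ∉ S → y ∉ S →
    Relation.ReflTransGen (fun a b => ∃ e ∈ F, Disjoint e S ∧ a ∈ e ∧ b ∈ e) x y

/-- `F` is 3-connected: at least 4 vertices, and no set of at most 2 vertices disconnects it. -/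
def ThreeConnected {r : ℕ} (F : Finset (Finset (Fin r))) : Prop :=
  4 ≤ r ∧ ∀ S : Finset (Fin r), S.card ≤ 2 → ConnectedAvoiding F S

/-- Two edge sets on `Fin r` are isomorphic via a permutation of the vertices. -/
def EdgeIso {r : ℕ} (F F' : Finset (Finset (Fin r))) : Prop :=
  ∃ σ : Equiv.Perm (Fin r), F.image (fun e => e.image (fun x => σ x)) = F'

/-- `F` is nice: strictly 1-balanced, 3-connected and either `u ≥ 3` or `u = 2` and `F`
cannot be transformed into an isomorphic graph by adding one edge and deleting one edge. -/
def Nice {r : ℕ} (u : ℕ) (F : Finset (Finset (Fin r))) : Prop :=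
  StrictlyOneBalanced F ∧ ThreeConnected F ∧
    (3 ≤ u ∨ (u = 2 ∧ ¬ ∃ a b : Finset (Fin r), a.card = u ∧ a ∉ F ∧ b ∈ F ∧
      EdgeIso (insert a (F.erase b)) F))

/-- `h` is an `F`-edge on `[n]`: a copy of `F`, recorded as its (`r`-element) vertex set
together with its `u`-edge set. -/
def IsFEdge {r : ℕ} (F : Finset (Finset (Fin r))) (n : ℕ) (h : FE n) : Prop :=
  ∃ φ : Fin r ↪ Fin n, h.1 = Finset.univ.map φ ∧ h.2 = F.image (fun e => e.map φ)

/-- All possible `F`-edges on `[n]`. -/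
def allFEdges {r : ℕ} (F : Finset (Finset (Fin r))) (n : ℕ) : Finset (FE n) :=
  Finset.univ.filter (fun h => IsFEdge F n h)

/-- `M`, the total number of `F`-edges on `[n]`. -/
def Mnum {r : ℕ} (F : Finset (Finset (Fin r))) (n : ℕ) : ℕ := (allFEdges F n).card

/-- All `u`-element subsets of `[n]`. -/
def allUEdges (u n : ℕ) : Finset (Finset (Fin n)) :=
  Finset.univ.filter (fun e : Finset (Fin n) => e.card = u)

/-- The number of automorphisms of `F`. -/
def autCard {r : ℕ} (F : Finset (Finset (Fin r))) : ℕ :=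
  Fintype.card {σ : Equiv.Perm (Fin r) // F.image (fun e => e.image (fun x => σ x)) = F}

/-- The degree of a vertex `v` in an `F`-graph `H`. -/
def degFE {n : ℕ} (H : Finset (FE n)) (v : Fin n) : ℕ :=
  (H.filter (fun h => v ∈ h.1)).card

/-- Two `F`-edges are partners if their vertex sets share exactly `u` vertices. -/
def Partner (u : ℕ) {n : ℕ} (h h' : FE n) : Prop :=
  h ≠ h' ∧ (h.1 ∩ h'.1).card = u

/-- The state at time `t` of the process induced by the ordering `f`. -/
def proc {α : Type*} [DecidableEq α] {m : ℕ} (f : Fin m → α) (t : ℕ) : Finset α :=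
  (Finset.univ.filter (fun i : Fin m => (i : ℕ) < t)).image f

/-- A valid ordering of all `u`-element subsets of `[n]`. -/
def ValidOrdU (u n : ℕ) (f : Fin (Nat.choose n u) → Finset (Fin n)) : Prop :=
  Function.Injective f ∧ ∀ e : Finset (Fin n), e.card = u → ∃ i, f i = e

/-- A valid ordering of all `r`-element subsets of `[n]`. -/
def ValidOrdR (r n : ℕ) (f : Fin (Nat.choose n r) → Finset (Fin n)) : Prop :=
  Function.Injective f ∧ ∀ e : Finset (Fin n), e.card = r → ∃ i, f i = e

/-- A valid ordering of all `F`-edges on `[n]`. -/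
def ValidOrdH {r : ℕ} (F : Finset (Finset (Fin r))) (n : ℕ)
    (f : Fin (Mnum F n) → FE n) : Prop :=
  Function.Injective f ∧ ∀ h : FE n, IsFEdge F n h → ∃ i, f i = h

/-- `T_H`: the first time at which the `F`-graph process has no isolated vertices. -/
def THit {r : ℕ} (F : Finset (Finset (Fin r))) (n : ℕ) (f : Fin (Mnum F n) → FE n) : ℕ :=
  sInf {t : ℕ | ∀ v : Fin n, ∃ h ∈ proc f t, v ∈ h.1}

/-- `T_E`: the first time at which the `r`-uniform hypergraph process has no isolated
vertices. -/
def TEHit (r n : ℕ) (f : Fin (Nat.choose n r) → Finset (Fin n)) : ℕ :=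
  sInf {t : ℕ | ∀ v : Fin n, ∃ e ∈ proc f t, v ∈ e}

/-- `T_G`: the first time at which every vertex of `[n]` lies in a copy of `F` in the
`u`-graph process. -/
def TGHit (u : ℕ) {r : ℕ} (F : Finset (Finset (Fin r))) (n : ℕ)
    (f : Fin (Nat.choose n u) → Finset (Fin n)) : ℕ :=
  sInf {t : ℕ | ∀ v : Fin n, ∃ h : FE n, IsFEdge F n h ∧ v ∈ h.1 ∧ h.2 ⊆ proc f t}

/-- The random variable `X` is uniformly distributed over `{a | P a}` under `μ`. -/
def UniformOn {Ω α : Type*} (μ : PMF Ω) (X : Ω → α) (P : α → Prop) : Prop :=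
  μ.toOuterMeasure {ω | P (X ω)} = 1 ∧
    ∀ a b : α, P a → P b →
      μ.toOuterMeasure {ω | X ω = a} = μ.toOuterMeasure {ω | X ω = b}

/-- Under `μ`, the random set `X` contains each element of `all` independently with
probability `p` (a Bernoulli product / binomial random subset distribution). -/
def BernoulliVia {Ω E : Type*} (μ : PMF Ω) (X : Ω → Finset E)
    (all : Finset E) (p : ℝ) : Prop :=
  ∀ A : Finset E, μ.toOuterMeasure {ω | X ω = A} =
    if A ⊆ all then ENNReal.ofReal (p ^ A.card * (1 - p) ^ (all.card - A.card)) else 0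

/-- The function `g` tends to infinity and is `o(log n / log log n)`. -/
def GoodG (g : ℕ → ℝ) : Prop :=
  Tendsto g atTop atTop ∧ g =o[atTop] fun n : ℕ => Real.log n / Real.log (Real.log n)

/-- `π₊`, the probability at the end of the critical window. -/
def piPlus {r : ℕ} (F : Finset (Finset (Fin r))) (g : ℕ → ℝ) (n : ℕ) : ℝ :=
  ((autCard F : ℝ) / (Nat.factorial r : ℝ)) *
    ((Real.log n + g n) / ((n - 1).choose (r - 1) : ℝ))

/-- `π₋`, the probability at the start of the critical window. -/
def piMinus {r : ℕ} (F : Finset (Finset (Fin r))) (g : ℕ → ℝ) (n : ℕ) : ℝ :=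
  ((autCard F : ℝ) / (Nat.factorial r : ℝ)) *
    ((Real.log n - g n) / ((n - 1).choose (r - 1) : ℝ))

/-- `p₊ = (π₊/(1-n^{-δ}))^{1/s}` where `s = e(F)`. -/
def pPlus {r : ℕ} (F : Finset (Finset (Fin r))) (g : ℕ → ℝ) (δ : ℝ) (n : ℕ) : ℝ :=
  (piPlus F g n / (1 - (n : ℝ) ^ (-δ))) ^ ((1 : ℝ) / (F.card : ℝ))

/-- Connectivity (as a multihypergraph of vertex sets) of a set of `F`-edges. -/
def ConnFE {n : ℕ} (S : Finset (FE n)) : Prop :=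
  ∀ a ∈ S, ∀ b ∈ S,
    Relation.ReflTransGen (fun x y : FE n => x ∈ S ∧ y ∈ S ∧ (x.1 ∩ y.1).Nonempty) a b

/-- The multihypergraph of vertex sets of the `F`-edges of `H` contains an avoidable
configuration: a connected `S ⊆ H` with nullity `(r-1)e(S)+1-v(S) > 1` and
`e(S) ≤ 2^(r+1)`. -/
def HasAvoidable (r : ℕ) {n : ℕ} (H : Finset (FE n)) : Prop :=
  ∃ S ⊆ H, S.Nonempty ∧ ConnFE S ∧
    (S.sup Prod.fst).card < (r - 1) * S.card ∧ S.card ≤ 2 ^ (r + 1)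

/-- `G` contains an `F`-factor: pairwise vertex-disjoint copies of `F`, each a subgraph
of `G`, whose vertex sets partition `[n]`. -/
def HasFFactor {r : ℕ} (F : Finset (Finset (Fin r))) (n : ℕ)
    (G : Finset (Finset (Fin n))) : Prop :=
  ∃ C : Finset (FE n), (∀ h ∈ C, IsFEdge F n h ∧ h.2 ⊆ G) ∧
    (∀ h ∈ C, ∀ h' ∈ C, h ≠ h' → Disjoint h.1 h'.1) ∧
    C.sup Prod.fst = Finset.univ ∧ C.card * r = n


/-! ### Helper lemmas -/

lemma hp_sum_disj {E : Type*} [Fintype E] (all S : Finset E) (hS : S ⊆ all) (p : ℝ) :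
    (∑ A : Finset E, (if A ⊆ all then p ^ A.card * (1 - p) ^ (all.card - A.card) else 0) *
      (if Disjoint A S then (1:ℝ) else 0)) = (1 - p) ^ S.card := by
  have h1 : ∀ A : Finset E, (if A ⊆ all then p ^ A.card * (1 - p) ^ (all.card - A.card) else 0) *
      (if Disjoint A S then (1:ℝ) else 0) =
      if A ∈ (all \ S).powerset then
        p ^ A.card * (1 - p) ^ ((all \ S).card - A.card) * (1 - p) ^ S.card else 0 := by
    intro A
    by_cases hA : A ∈ (all \ S).powerset
    · have hA' := Finset.mem_powerset.mp hA
      have h2 : A ⊆ all := hA'.trans Finset.sdiff_subset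
      have h3 : Disjoint A S := Finset.disjoint_of_subset_left hA' Finset.sdiff_disjoint
      have h4 : (all \ S).card + S.card = all.card := Finset.card_sdiff_add_card_eq_card hS
      have h5 := Finset.card_le_card hA'
      rw [if_pos h2, if_pos h3, if_pos hA, mul_one, mul_assoc, ← pow_add]
      congr 2
      omega
    · rw [if_neg hA]
      by_cases h2 : A ⊆ all
      · by_cases h3 : Disjoint A S
        · exact absurd (Finset.mem_powerset.mpr (Finset.subset_sdiff.mpr ⟨h2, h3⟩)) hA
        · simp [h3]
      · simp [h2]
  rw [Finset.sum_congr rfl (fun A _ => h1 A), Finset.sum_ite_mem, Finset.univ_inter,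
    ← Finset.sum_mul, Finset.sum_pow_mul_eq_add_pow]
  simp

lemma hp_card_aut {r n : ℕ} (F : Finset (Finset (Fin r))) :
    (allFEdges F n).card * autCard F = n.descFactorial r := by
  let T : (Fin r ↪ Fin n) → FE n :=
    fun φ => (Finset.univ.map φ, F.image (fun e => e.map φ))
  have h0 : Fintype.card (Fin r ↪ Fin n) = n.descFactorial r := by
    simp [Fintype.card_embedding_eq]
  rw [← h0, ← Finset.card_univ]
  symm
  rw [mul_comm]
  have hmap : ∀ φ ∈ (Finset.univ : Finset (Fin r ↪ Fin n)), T φ ∈ allFEdges F n := by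
    intro φ _
    simp only [allFEdges, Finset.mem_filter, Finset.mem_univ, true_and]
    exact ⟨φ, rfl, rfl⟩
  rw [Finset.card_eq_sum_card_fiberwise hmap, Finset.sum_const_nat (m := autCard F), mul_comm]
  intro h hh
  obtain ⟨φ, h1, h2⟩ := (Finset.mem_filter.mp hh).2
  have hh' : h = T φ := Prod.ext h1 h2
  subst hh'
  unfold autCard
  rw [← Fintype.card_coe]
  symm
  have key : ∀ σ : Equiv.Perm (Fin r),
      F.image (fun e => e.map (σ.toEmbedding.trans φ)) =
        (F.image (fun e => e.image (fun x => σ x))).image (fun e => e.map φ) := by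
    intro σ
    rw [Finset.image_image]
    apply Finset.image_congr
    intro e _
    ext x
    simp
  apply Fintype.card_of_bijective
    (f := fun σ => ⟨σ.1.toEmbedding.trans φ, by
      simp only [Finset.mem_filter, Finset.mem_univ, true_and, T]
      refine Prod.ext ?_ ?_
      · simp [← Finset.map_map]
      · simp only
        rw [key, σ.2]⟩)
  constructor
  · intro σ τ hst
    apply Subtype.ext
    ext x
    have := congrArg (fun f => f.1 x) hst
    simpa using congrArg Fin.val (φ.injective this)
  · rintro ⟨ψ, hψ⟩
    simp only [Finset.mem_filter, Finset.mem_univ, true_and, T, Prod.mk.injEq] at hψ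
    have hex : ∀ x, ∃ y, φ y = ψ x := by
      intro x
      have : ψ x ∈ Finset.univ.map φ := by
        rw [← hψ.1]; simp
      simpa using this
    choose s hs using hex
    have sinj : Function.Injective s := by
      intro a b hab
      apply ψ.injective
      rw [← hs, ← hs, hab]
    let σ : Equiv.Perm (Fin r) := Equiv.ofBijective s (Finite.injective_iff_bijective.mp sinj)
    have hσ : σ.toEmbedding.trans φ = ψ := by
      ext x
      simp [σ, hs]
    refine ⟨⟨σ, ?_⟩, Subtype.ext hσ⟩
    have h3 := hψ.2
    rw [← hσ, key] at h3
    exact Finset.image_injective (Finset.map_injective φ) h3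

/-- The F-edges through a vertex. -/
def hpN {r : ℕ} (F : Finset (Finset (Fin r))) (n : ℕ) (v : Fin n) : Finset (FE n) :=
  (allFEdges F n).filter (fun h => v ∈ h.1)

lemma hp_card_fst {r n : ℕ} (F : Finset (Finset (Fin r))) (h : FE n) (hh : h ∈ allFEdges F n) :
    h.1.card = r := by
  obtain ⟨φ, h1, h2⟩ := (Finset.mem_filter.mp hh).2
  rw [h1]; simp

lemma hp_perm_mem {r n : ℕ} (F : Finset (Finset (Fin r))) (σ : Equiv.Perm (Fin n)) (h : FE n)
    (hh : h ∈ allFEdges F n) :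
    ((h.1.map σ.toEmbedding, h.2.image (fun e => e.map σ.toEmbedding)) : FE n)
      ∈ allFEdges F n := by
  obtain ⟨φ, h1, h2⟩ := (Finset.mem_filter.mp hh).2
  simp only [allFEdges, Finset.mem_filter, Finset.mem_univ, true_and]
  refine ⟨φ.trans σ.toEmbedding, ?_, ?_⟩
  · simp only [h1, Finset.map_map]
  · simp only [h2, Finset.image_image]
    apply Finset.image_congr
    intro e _
    simp [Finset.map_map]

lemma hp_perm_inj {n : ℕ} (σ : Equiv.Perm (Fin n)) :
    Function.Injective (fun h : FE n =>
      ((h.1.map σ.toEmbedding, h.2.image (fun e => e.map σ.toEmbedding)) : FE n)) := by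
  intro a b hab
  simp only [Prod.mk.injEq] at hab
  exact Prod.ext (Finset.map_injective _ hab.1)
    (Finset.image_injective (Finset.map_injective _) hab.2)

lemma hp_inter_le {r n : ℕ} (F : Finset (Finset (Fin r))) (σ : Equiv.Perm (Fin n))
    (v w : Fin n) :
    (hpN F n v ∩ hpN F n w).card ≤ (hpN F n (σ v) ∩ hpN F n (σ w)).card := by
  apply Finset.card_le_card_of_injOn (fun h : FE n =>
      ((h.1.map σ.toEmbedding, h.2.image (fun e => e.map σ.toEmbedding)) : FE n))
  · intro h hh
    simp only [hpN, Finset.coe_inter, Set.mem_inter_iff, Finset.mem_coe, Finset.mem_filter] at hh ⊢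
    refine ⟨⟨hp_perm_mem F σ h hh.1.1, ?_⟩, ⟨hp_perm_mem F σ h hh.1.1, ?_⟩⟩
    · simpa using hh.1.2
    · simpa using hh.2.2
  · exact (hp_perm_inj σ).injOn

lemma hp_deg_eq {r n : ℕ} (F : Finset (Finset (Fin r))) (v w : Fin n) :
    (hpN F n v).card = (hpN F n w).card := by
  apply le_antisymm
  · simpa using hp_inter_le F (Equiv.swap v w) v v
  · simpa using hp_inter_le F (Equiv.swap v w) w w

lemma hp_codeg_eq {r n : ℕ} (F : Finset (Finset (Fin r))) (v w w' : Fin n) (hw : v ≠ w)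
    (hw' : v ≠ w') :
    (hpN F n v ∩ hpN F n w).card = (hpN F n v ∩ hpN F n w').card := by
  have hs : Equiv.swap w w' v = v := Equiv.swap_apply_of_ne_of_ne hw hw'
  apply le_antisymm
  · simpa [hs] using hp_inter_le F (Equiv.swap w w') v w
  · simpa [hs] using hp_inter_le F (Equiv.swap w w') v w'

lemma hp_double {r n : ℕ} (F : Finset (Finset (Fin r))) (S : Finset (FE n))
    (hS : S ⊆ allFEdges F n) :
    ∑ w : Fin n, (S ∩ hpN F n w).card = r * S.card := by
  have h1 : ∀ w, (S ∩ hpN F n w).card = ∑ h ∈ S, if w ∈ h.1 then 1 else 0 := by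
    intro w
    rw [← Finset.card_filter]
    congr 1
    ext h
    simp only [hpN, Finset.mem_inter, Finset.mem_filter]
    constructor
    · rintro ⟨a, b, c⟩; exact ⟨a, c⟩
    · rintro ⟨a, c⟩; exact ⟨a, hS a, c⟩
  simp_rw [h1]
  rw [Finset.sum_comm, Finset.sum_const_nat (m := r), mul_comm]
  intro h hh
  rw [← hp_card_fst F h (hS hh)]
  simp

lemma hp_N_sub {r n : ℕ} (F : Finset (Finset (Fin r))) (v : Fin n) :
    hpN F n v ⊆ allFEdges F n := Finset.filter_subset _ _

lemma hp_deg_count {r n : ℕ} (F : Finset (Finset (Fin r))) (v : Fin n) :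
    n * (hpN F n v).card = r * (allFEdges F n).card := by
  rw [← hp_double F _ (Finset.Subset.refl _)]
  rw [Finset.sum_const_nat (m := (hpN F n v).card)]
  · simp
  · intro w _
    rw [Finset.inter_eq_right.mpr (hp_N_sub F w)]
    exact hp_deg_eq F w v

lemma hp_codeg_count {r n : ℕ} (F : Finset (Finset (Fin r))) (v w : Fin n) (hvw : v ≠ w) :
    (n - 1) * (hpN F n v ∩ hpN F n w).card = (r - 1) * (hpN F n v).card := by
  have h := hp_double F (hpN F n v) (hp_N_sub F v)
  rw [← Finset.add_sum_erase _ _ (Finset.mem_univ v), Finset.inter_self,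
    Finset.sum_const_nat (m := (hpN F n v ∩ hpN F n w).card)] at h
  · simp only [Finset.card_erase_of_mem (Finset.mem_univ v), Finset.card_univ,
      Fintype.card_fin] at h
    rw [Nat.sub_mul r, one_mul, ← h]
    omega
  · intro x hx
    exact hp_codeg_eq F v x w (Finset.ne_of_mem_erase hx).symm hvw

lemma hp_deg_formula {r n : ℕ} (hr : 1 ≤ r) (F : Finset (Finset (Fin r))) (v : Fin n) :
    (hpN F n v).card * autCard F = r.factorial * (n - 1).choose (r - 1) := by
  have hn : 0 < n := v.pos
  apply Nat.eq_of_mul_eq_mul_left hn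
  rw [← mul_assoc, hp_deg_count, mul_assoc, hp_card_aut]
  obtain ⟨m, rfl⟩ : ∃ m, n = m + 1 := ⟨n - 1, by omega⟩
  obtain ⟨s, rfl⟩ : ∃ s, r = s + 1 := ⟨r - 1, by omega⟩
  rw [Nat.succ_descFactorial_succ, Nat.descFactorial_eq_factorial_mul_choose]
  simp only [Nat.add_sub_cancel, Nat.factorial_succ]
  ring

lemma hp_aut_pos {r : ℕ} (F : Finset (Finset (Fin r))) : 0 < autCard F := by
  unfold autCard
  rw [Fintype.card_pos_iff]
  exact ⟨⟨1, by simp⟩⟩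

/-- Real weight of an outcome. -/
def hpW {r : ℕ} (F : Finset (Finset (Fin r))) (n : ℕ) (p : ℝ) (A : Finset (FE n)) : ℝ :=
  if A ⊆ allFEdges F n then p ^ A.card * (1 - p) ^ ((allFEdges F n).card - A.card) else 0

/-- Real probability of having an isolated vertex. -/
def hpP {r : ℕ} (F : Finset (Finset (Fin r))) (n : ℕ) (p : ℝ) : ℝ :=
  ∑ A : Finset (FE n), hpW F n p A * if ∃ v : Fin n, ∀ h ∈ A, v ∉ h.1 then 1 else 0

lemma hp_W_nonneg {r : ℕ} (F : Finset (Finset (Fin r))) (n : ℕ) (p : ℝ)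
    (hp : p ∈ Set.Icc (0:ℝ) 1) (A : Finset (FE n)) : 0 ≤ hpW F n p A := by
  unfold hpW
  have h1 := hp.1
  have h2 : 0 ≤ 1 - p := sub_nonneg.mpr hp.2
  split_ifs <;> positivity

lemma hp_prob {r : ℕ} (F : Finset (Finset (Fin r))) (n : ℕ) (p : ℝ)
    (hp : p ∈ Set.Icc (0:ℝ) 1) (μ : PMF (Finset (FE n)))
    (hμ : BernoulliVia μ id (allFEdges F n) p) :
    μ.toOuterMeasure {H | ∃ v : Fin n, ∀ h ∈ H, v ∉ h.1} = ENNReal.ofReal (hpP F n p) := by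
  have h1 : ∀ A, μ A = ENNReal.ofReal (hpW F n p A) := by
    intro A
    have := hμ A
    simp only [id, Set.ofPred_eq_eq_singleton, PMF.toOuterMeasure_apply_singleton] at this
    rw [this]
    unfold hpW
    split_ifs <;> simp
  rw [PMF.toOuterMeasure_apply_fintype, hpP, ENNReal.ofReal_sum_of_nonneg]
  · apply Finset.sum_congr rfl
    intro A _
    by_cases h : ∃ v : Fin n, ∀ h ∈ A, v ∉ h.1
    · rw [Set.indicator_of_mem (by exact h), if_pos h, mul_one, h1]
    · rw [Set.indicator_of_notMem (by exact h), if_neg h]; simp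
  · intro A _
    apply mul_nonneg (hp_W_nonneg F n p hp A)
    split_ifs <;> norm_num

lemma hp_W_disj {r : ℕ} (F : Finset (Finset (Fin r))) (n : ℕ) (p : ℝ) (S : Finset (FE n))
    (hS : S ⊆ allFEdges F n) :
    ∑ A : Finset (FE n), hpW F n p A * (if Disjoint A S then (1:ℝ) else 0) = (1 - p) ^ S.card := by
  have := hp_sum_disj (allFEdges F n) S hS p
  rw [← this]
  apply Finset.sum_congr rfl
  intro A _
  unfold hpW
  congr

lemma hp_W_sum {r : ℕ} (F : Finset (Finset (Fin r))) (n : ℕ) (p : ℝ) :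
    ∑ A : Finset (FE n), hpW F n p A = 1 := by
  have := hp_W_disj F n p ∅ (by simp)
  simpa using this

lemma hp_iso_iff {r n : ℕ} (F : Finset (Finset (Fin r))) (A : Finset (FE n))
    (hA : A ⊆ allFEdges F n) (v : Fin n) : (∀ h ∈ A, v ∉ h.1) ↔ Disjoint A (hpN F n v) := by
  rw [Finset.disjoint_left]
  constructor
  · intro h a ha hb
    exact h a ha (Finset.mem_filter.mp hb).2
  · intro h a ha hb
    exact h ha (Finset.mem_filter.mpr ⟨hA ha, hb⟩)

/-- Number of isolated vertices. -/
def hpX {r : ℕ} (F : Finset (Finset (Fin r))) (n : ℕ) (A : Finset (FE n)) : ℝ :=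
  ∑ v : Fin n, if Disjoint A (hpN F n v) then 1 else 0

lemma hp_first {r : ℕ} (F : Finset (Finset (Fin r))) (n d : ℕ) (p : ℝ)
    (hd : ∀ v, (hpN F n v).card = d) :
    ∑ A : Finset (FE n), hpW F n p A * hpX F n A = n * (1 - p) ^ d := by
  unfold hpX
  simp_rw [Finset.mul_sum]
  rw [Finset.sum_comm]
  rw [Finset.sum_congr rfl (fun v _ => hp_W_disj F n p _ (hp_N_sub F v))]
  simp [hd]

lemma hp_upper {r : ℕ} (F : Finset (Finset (Fin r))) (n d : ℕ) (p : ℝ)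
    (hp : p ∈ Set.Icc (0:ℝ) 1) (hd : ∀ v, (hpN F n v).card = d) :
    hpP F n p ≤ n * (1 - p) ^ d := by
  rw [← hp_first F n d p hd, hpP]
  apply Finset.sum_le_sum
  intro A _
  by_cases hA : A ⊆ allFEdges F n
  · apply mul_le_mul_of_nonneg_left _ (hp_W_nonneg F n p hp A)
    have hnn : ∀ v ∈ (Finset.univ : Finset (Fin n)),
        (0:ℝ) ≤ if Disjoint A (hpN F n v) then 1 else 0 := by
      intro v _; split_ifs <;> norm_num
    split_ifs with h
    · obtain ⟨v, hv⟩ := h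
      have := Finset.single_le_sum hnn (Finset.mem_univ v)
      rw [if_pos ((hp_iso_iff F A hA v).mp hv)] at this
      exact this
    · exact Finset.sum_nonneg hnn
  · simp [hpW, hA]

lemma hp_second {r : ℕ} (F : Finset (Finset (Fin r))) (n d d2 : ℕ) (p : ℝ)
    (hp0 : 0 ≤ p) (hp1 : p < 1) (hd : ∀ v, (hpN F n v).card = d)
    (hd2 : ∀ v w, v ≠ w → (hpN F n v ∩ hpN F n w).card = d2) :
    ∑ A : Finset (FE n), hpW F n p A * (hpX F n A) ^ 2 ≤
      n * (1 - p) ^ d + n ^ 2 * ((1 - p) ^ (2 * d) / (1 - p) ^ d2) := by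
  have hq : 0 < 1 - p := by linarith
  have h1 : ∀ A : Finset (FE n), hpW F n p A * (hpX F n A) ^ 2 =
      ∑ v, ∑ w, hpW F n p A * if Disjoint A (hpN F n v ∪ hpN F n w) then 1 else 0 := by
    intro A
    unfold hpX
    rw [sq, Finset.sum_mul_sum, Finset.mul_sum]
    apply Finset.sum_congr rfl
    intro v _
    rw [Finset.mul_sum]
    apply Finset.sum_congr rfl
    intro w _
    have hu : Disjoint A (hpN F n v ∪ hpN F n w) ↔
        Disjoint A (hpN F n v) ∧ Disjoint A (hpN F n w) := Finset.disjoint_union_right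
    by_cases a : Disjoint A (hpN F n v) <;> by_cases b : Disjoint A (hpN F n w) <;>
      simp [hu, a, b]
  simp_rw [h1]
  rw [Finset.sum_comm]
  have h2 : ∀ v : Fin n, ∑ A : Finset (FE n), ∑ w, (hpW F n p A *
      if Disjoint A (hpN F n v ∪ hpN F n w) then (1:ℝ) else 0) ≤
      (1 - p) ^ d + n * ((1 - p) ^ (2 * d) / (1 - p) ^ d2) := by
    intro v
    rw [Finset.sum_comm]
    have h3 : ∀ w : Fin n, ∑ A : Finset (FE n), (hpW F n p A *
      if Disjoint A (hpN F n v ∪ hpN F n w) then (1:ℝ) else 0) ≤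
        (if v = w then (1 - p) ^ d else 0) + (1 - p) ^ (2 * d) / (1 - p) ^ d2 := by
      intro w
      rw [hp_W_disj F n p _ (Finset.union_subset (hp_N_sub F v) (hp_N_sub F w))]
      by_cases hvw : v = w
      · subst hvw
        rw [if_pos rfl, Finset.union_self, hd]
        have : 0 ≤ (1 - p) ^ (2 * d) / (1 - p) ^ d2 := by positivity
        linarith
      · rw [if_neg hvw, zero_add, le_div_iff₀ (by positivity), ← pow_add]
        have h4 := Finset.card_union_add_card_inter (hpN F n v) (hpN F n w)
        rw [hd2 v w hvw, hd, hd, ← two_mul] at h4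
        rw [h4]
    refine (Finset.sum_le_sum (fun w _ => h3 w)).trans ?_
    rw [Finset.sum_add_distrib]
    simp
  refine (Finset.sum_le_sum (fun v _ => h2 v)).trans ?_
  simp only [Finset.sum_const, Finset.card_univ, Fintype.card_fin, nsmul_eq_mul]
  apply le_of_eq
  ring

lemma hp_P_le_one {r : ℕ} (F : Finset (Finset (Fin r))) (n : ℕ) (p : ℝ)
    (hp : p ∈ Set.Icc (0:ℝ) 1) : hpP F n p ≤ 1 := by
  rw [← hp_W_sum F n p, hpP]
  apply Finset.sum_le_sum
  intro A _
  have := hp_W_nonneg F n p hp A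
  split_ifs <;> simp [this]

lemma hp_P_nonneg {r : ℕ} (F : Finset (Finset (Fin r))) (n : ℕ) (p : ℝ)
    (hp : p ∈ Set.Icc (0:ℝ) 1) : 0 ≤ hpP F n p := by
  apply Finset.sum_nonneg
  intro A _
  have := hp_W_nonneg F n p hp A
  split_ifs <;> simp [this]

lemma hp_lower {r : ℕ} (F : Finset (Finset (Fin r))) (n d d2 : ℕ) (p : ℝ) (hn : 0 < n)
    (hp0 : 0 ≤ p) (hp1 : p < 1) (hd : ∀ v, (hpN F n v).card = d)
    (hd2 : ∀ v w, v ≠ w → (hpN F n v ∩ hpN F n w).card = d2) :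
    2 - 1 / (n * (1 - p) ^ d) - 1 / (1 - p) ^ d2 ≤ hpP F n p := by
  have hq : 0 < 1 - p := by linarith
  have hp : p ∈ Set.Icc (0:ℝ) 1 := ⟨hp0, hp1.le⟩
  have hn' : (0:ℝ) < n := by exact_mod_cast hn
  set m : ℝ := n * (1 - p) ^ d with hm
  have hmpos : 0 < m := by positivity
  have h1 := hp_first F n d p hd
  have h2 := hp_second F n d d2 p hp0 hp1 hd hd2
  have h3 := hp_W_sum F n p
  have key : m ^ 2 * (1 - hpP F n p) ≤
      ∑ A : Finset (FE n), hpW F n p A * (hpX F n A) ^ 2 - m ^ 2 := by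
    have e1 : m ^ 2 * (1 - hpP F n p) = ∑ A : Finset (FE n), hpW F n p A *
        (m ^ 2 * (1 - if ∃ v : Fin n, ∀ h ∈ A, v ∉ h.1 then 1 else 0)) := by
      conv_lhs => rw [← h3, hpP, ← Finset.sum_sub_distrib, Finset.mul_sum]
      apply Finset.sum_congr rfl
      intro A _
      ring
    have e2 : ∑ A : Finset (FE n), hpW F n p A * (hpX F n A) ^ 2 - m ^ 2 =
        ∑ A : Finset (FE n), hpW F n p A * (hpX F n A - m) ^ 2 := by
      have : ∀ A : Finset (FE n), hpW F n p A * (hpX F n A - m) ^ 2 =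
          hpW F n p A * (hpX F n A) ^ 2 - 2 * m * (hpW F n p A * hpX F n A)
            + m ^ 2 * hpW F n p A := by intro A; ring
      simp_rw [this]
      rw [Finset.sum_add_distrib, Finset.sum_sub_distrib, ← Finset.mul_sum, ← Finset.mul_sum,
        h1, h3]
      ring
    rw [e1, e2]
    apply Finset.sum_le_sum
    intro A _
    by_cases hA : A ⊆ allFEdges F n
    · apply mul_le_mul_of_nonneg_left _ (hp_W_nonneg F n p hp A)
      split_ifs with h
      · simp only [sub_self, mul_zero]; positivity
      · have : hpX F n A = 0 := by
          unfold hpX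
          apply Finset.sum_eq_zero
          intro v _
          rw [if_neg]
          intro hv
          exact h ⟨v, (hp_iso_iff F A hA v).mpr hv⟩
        rw [this]
        apply le_of_eq
        ring
    · simp [hpW, hA]
  have h4 : m ^ 2 * (1 / m + 1 / (1 - p) ^ d2) =
      n * (1 - p) ^ d + n ^ 2 * ((1 - p) ^ (2 * d) / (1 - p) ^ d2) := by
    have : m ^ 2 * (1 / m + 1 / (1 - p) ^ d2) = m + m ^ 2 / (1 - p) ^ d2 := by
      field_simp
    rw [this, hm]
    ring
  have h5 : m ^ 2 * (1 - hpP F n p) ≤ m ^ 2 * (1 / m + 1 / (1 - p) ^ d2 - 1) := by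
    rw [mul_sub _ (1 / m + 1 / (1 - p) ^ d2) 1, h4]; linarith
  have h6 := le_of_mul_le_mul_left h5 (by positivity)
  linarith

/-- Common degree and codegree. -/
lemma hp_params {r n : ℕ} (hr : 4 ≤ r) (hn : r ≤ n) (F : Finset (Finset (Fin r))) :
    ∃ d d2 : ℕ, 0 < d ∧ (∀ v, (hpN F n v).card = d) ∧
      (∀ v w, v ≠ w → (hpN F n v ∩ hpN F n w).card = d2) ∧
      (n - 1) * d2 = (r - 1) * d ∧ 0 < d2 ∧
      d * autCard F = r.factorial * (n - 1).choose (r - 1) := by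
  let v0 : Fin n := ⟨0, by omega⟩
  let v1 : Fin n := ⟨1, by omega⟩
  have h01 : v0 ≠ v1 := by simp [v0, v1]
  have hf := hp_deg_formula (by omega : 1 ≤ r) F v0
  have hc : 0 < (n - 1).choose (r - 1) := Nat.choose_pos (by omega)
  have hdpos : 0 < (hpN F n v0).card := by
    have hpos : 0 < (hpN F n v0).card * autCard F := by
      rw [hf]
      positivity
    exact Nat.pos_of_mul_pos_right hpos
  have hcc := hp_codeg_count F v0 v1 h01
  refine ⟨_, (hpN F n v0 ∩ hpN F n v1).card, hdpos, fun v => hp_deg_eq F v v0, ?_, hcc, ?_, hf⟩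
  · intro v w hvw
    have := hp_codeg_count F v w hvw
    rw [hp_deg_eq F v v0, ← hcc] at this
    exact Nat.eq_of_mul_eq_mul_left (by omega) this
  · rcases Nat.eq_zero_or_pos (hpN F n v0 ∩ hpN F n v1).card with h | h
    · rw [h, mul_zero] at hcc
      have : 0 < (r - 1) * (hpN F n v0).card := Nat.mul_pos (by omega) hdpos
      omega
    · exact h

lemma hp_pi_eq {r n d : ℕ} (hn : r ≤ n) (hr : 4 ≤ r) (F : Finset (Finset (Fin r))) (x : ℝ)
    (hd : d * autCard F = r.factorial * (n - 1).choose (r - 1)) :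
    (d : ℝ) * (((autCard F : ℝ) / (Nat.factorial r : ℝ)) *
      (x / ((n - 1).choose (r - 1) : ℝ))) = x := by
  have h1 : ((n - 1).choose (r - 1) : ℝ) ≠ 0 := by
    exact_mod_cast (Nat.choose_pos (by omega)).ne'
  have h2 : (r.factorial : ℝ) ≠ 0 := by exact_mod_cast r.factorial_ne_zero
  have h3 : (d : ℝ) * autCard F = r.factorial * (n - 1).choose (r - 1) := by exact_mod_cast hd
  calc (d : ℝ) * (((autCard F : ℝ) / (Nat.factorial r : ℝ)) *
      (x / ((n - 1).choose (r - 1) : ℝ)))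
      = (d * autCard F) * x / (r.factorial * (n - 1).choose (r - 1)) := by field_simp
    _ = x := by rw [h3]; field_simp

lemma hp_b_bound {r n : ℕ} (hr : 4 ≤ r) (hn : r ≤ n) (F : Finset (Finset (Fin r)))
    (g : ℕ → ℝ) (p : ℝ) (hp : p ∈ Set.Icc (0:ℝ) 1) (hpi : piPlus F g n ≤ p) :
    hpP F n p ≤ Real.exp (-g n) := by
  obtain ⟨d, d2, hd0, hd, hd2, hrel, hd20, hf⟩ := hp_params hr hn F
  have hnpos : (0:ℝ) < n := by exact_mod_cast (by omega : 0 < n)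
  have h1 := hp_upper F n d p hp hd
  have h2 : (d:ℝ) * piPlus F g n = Real.log n + g n := hp_pi_eq hn hr F _ hf
  have h3 : Real.log n + g n ≤ d * p := by
    rw [← h2]; exact mul_le_mul_of_nonneg_left hpi (by positivity)
  have h4 : (1 - p) ^ d ≤ Real.exp (-(d * p)) := by
    have : 1 - p ≤ Real.exp (-p) := Real.one_sub_le_exp_neg p
    calc (1 - p) ^ d ≤ (Real.exp (-p)) ^ d := pow_le_pow_left₀ (sub_nonneg.mpr hp.2) this d
      _ = Real.exp (-(d * p)) := by rw [← Real.exp_nat_mul]; ring_nf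
  calc hpP F n p ≤ n * (1 - p) ^ d := h1
    _ ≤ Real.exp (Real.log n) * Real.exp (-(d * p)) := by
      rw [Real.exp_log hnpos]; exact mul_le_mul_of_nonneg_left h4 hnpos.le
    _ ≤ Real.exp (-g n) := by
      rw [← Real.exp_add]; apply Real.exp_le_exp.mpr; linarith

lemma hp_a_bound {r n : ℕ} (hr : 4 ≤ r) (hn : r ≤ n) (F : Finset (Finset (Fin r)))
    (g : ℕ → ℝ) (p : ℝ) (hp : p ∈ Set.Icc (0:ℝ) 1) (hpi : p ≤ piMinus F g n) (hg : 0 ≤ g n)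
    (δ : ℝ) (hδ : δ = (r - 1) * (Real.log n / (n - 1))) (hδ2 : δ ≤ 1 / 2) :
    2 - Real.exp (-g n + 2 * (Real.log n * δ)) - 1 / (1 - δ) ≤ hpP F n p := by
  obtain ⟨d, d2, hd0, hd, hd2, hrel, hd20, hf⟩ := hp_params hr hn F
  have hnpos : (0:ℝ) < n := by exact_mod_cast (by omega : 0 < n)
  have hn1 : (1:ℝ) < n := by exact_mod_cast (by omega : 1 < n)
  have hr1 : (1:ℝ) < r := by exact_mod_cast (by omega : 1 < r)
  have hL : 0 ≤ Real.log n := Real.log_nonneg hn1.le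
  have h2 : (d:ℝ) * piMinus F g n = Real.log n - g n := hp_pi_eq hn hr F _ hf
  have h3 : d * p ≤ Real.log n - g n := by
    rw [← h2]; exact mul_le_mul_of_nonneg_left hpi (by positivity)
  have hdp0 : 0 ≤ d * p := mul_nonneg (by positivity) hp.1
  have hrel' : ((n:ℝ) - 1) * d2 = (r - 1) * d := by
    have := congrArg (Nat.cast : ℕ → ℝ) hrel
    rw [Nat.cast_mul, Nat.cast_mul, Nat.cast_sub (by omega), Nat.cast_sub (by omega)] at this
    simpa using this
  have hd21 : (1:ℝ) ≤ d2 := by exact_mod_cast hd20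
  have hδ' : δ * (n - 1) = (r - 1) * Real.log n := by
    rw [hδ]
    have : (n:ℝ) - 1 ≠ 0 := by linarith
    field_simp
  have hd2p : d2 * p ≤ δ := by
    have : (d2 * p) * ((n:ℝ) - 1) ≤ δ * (n - 1) := by
      rw [hδ']
      calc (d2 * p) * ((n:ℝ) - 1) = (((n:ℝ) - 1) * d2) * p := by ring
        _ = (r - 1) * (d * p) := by rw [hrel']; ring
        _ ≤ (r - 1) * Real.log n := mul_le_mul_of_nonneg_left (by linarith) (by linarith)
    exact le_of_mul_le_mul_right this (by linarith)
  have hpδ : p ≤ δ := le_trans (by nlinarith [hp.1]) hd2p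
  have hp0 := hp.1
  have hp2 : p ≤ 1 / 2 := hpδ.trans hδ2
  have hq : 0 < 1 - p := by linarith
  have hlow := hp_lower F n d d2 p (by omega) hp0 (by linarith) hd hd2
  have hb1 : 1 - δ ≤ (1 - p) ^ d2 := by
    have := one_add_mul_le_pow (a := -p) (by linarith) d2
    have h' : (1 + -p) = 1 - p := by ring
    rw [h'] at this
    linarith
  have hb2 : 1 / (1 - p) ^ d2 ≤ 1 / (1 - δ) := one_div_le_one_div_of_le (by linarith) hb1
  have hqe : Real.exp (-(p + 2 * p ^ 2)) ≤ 1 - p := by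
    have h5 : 1 + (p + 2 * p ^ 2) ≤ Real.exp (p + 2 * p ^ 2) := by
      linarith [Real.add_one_le_exp (p + 2 * p ^ 2)]
    rw [Real.exp_neg]
    rw [inv_le_comm₀ (Real.exp_pos _) hq]
    refine le_trans ?_ h5
    rw [inv_le_iff_one_le_mul₀ hq]
    nlinarith [mul_nonneg (sq_nonneg p) (by linarith : 0 ≤ 1 - 2 * p)]
  have hqd : Real.exp (-(d * p + 2 * (d * p * p))) ≤ (1 - p) ^ d := by
    calc Real.exp (-(d * p + 2 * (d * p * p))) = (Real.exp (-(p + 2 * p ^ 2))) ^ d := by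
          rw [← Real.exp_nat_mul]; ring_nf
      _ ≤ _ := pow_le_pow_left₀ (Real.exp_pos _).le hqe d
  have hdpp : d * p * p ≤ Real.log n * δ :=
    mul_le_mul (by linarith) hpδ hp0 hL
  have hm : Real.exp (g n - 2 * (Real.log n * δ)) ≤ n * (1 - p) ^ d := by
    calc Real.exp (g n - 2 * (Real.log n * δ))
        ≤ Real.exp (Real.log n + -(d * p + 2 * (d * p * p))) := by
          apply Real.exp_le_exp.mpr; linarith
      _ = n * Real.exp (-(d * p + 2 * (d * p * p))) := by rw [Real.exp_add, Real.exp_log hnpos]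
      _ ≤ _ := mul_le_mul_of_nonneg_left hqd hnpos.le
  have hb3 : 1 / (n * (1 - p) ^ d) ≤ Real.exp (-g n + 2 * (Real.log n * δ)) := by
    have := one_div_le_one_div_of_le (Real.exp_pos _) hm
    rw [one_div (Real.exp _), ← Real.exp_neg] at this
    refine this.trans (le_of_eq ?_)
    ring_nf
  linarith

lemma hp_lim (k : ℕ) : Tendsto (fun n : ℕ => Real.log n ^ k / ((n:ℝ) - 1)) atTop (nhds 0) := by
  have := (Real.tendsto_pow_log_div_mul_add_atTop 1 (-1) k one_ne_zero).comp
    (tendsto_natCast_atTop_atTop (R := ℝ))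
  refine this.congr (fun n => ?_)
  simp [Function.comp, sub_eq_add_neg]

/-- Critical window for isolated vertices in the random `F`-graph:
below `π₋` there is whp an isolated vertex; above `π₊` there is whp none. -/
theorem statement_5 (u r : ℕ) (hu : 2 ≤ u) (hr : 4 ≤ r)
    (F : Finset (Finset (Fin r))) (hFcard : ∀ e ∈ F, e.card = u) (hF : Nice u F)
    (g : ℕ → ℝ) (hg : GoodG g) :
    (∀ π : ℕ → ℝ, (∀ n, π n ∈ Set.Icc (0 : ℝ) 1) →
      (∀ᶠ n : ℕ in atTop, π n ≤ piMinus F g n) →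
      ∀ μ : (n : ℕ) → PMF (Finset (FE n)),
        (∀ n, BernoulliVia (μ n) id (allFEdges F n) (π n)) →
        Tendsto (fun n => (μ n).toOuterMeasure {H | ∃ v : Fin n, ∀ h ∈ H, v ∉ h.1})
          atTop (nhds 1)) ∧
    (∀ π : ℕ → ℝ, (∀ n, π n ∈ Set.Icc (0 : ℝ) 1) →
      (∀ᶠ n : ℕ in atTop, piPlus F g n ≤ π n) →
      ∀ μ : (n : ℕ) → PMF (Finset (FE n)),
        (∀ n, BernoulliVia (μ n) id (allFEdges F n) (π n)) →
        Tendsto (fun n => (μ n).toOuterMeasure {H | ∃ v : Fin n, ∀ h ∈ H, v ∉ h.1})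
          atTop (nhds 0)) := by
  
  obtain ⟨hg1, _⟩ := hg
  constructor
  · intro π hπ hle μ hμ
    have hfun : ∀ n, (μ n).toOuterMeasure {H | ∃ v : Fin n, ∀ h ∈ H, v ∉ h.1} =
        ENNReal.ofReal (hpP F n (π n)) := fun n => hp_prob F n (π n) (hπ n) (μ n) (hμ n)
    simp_rw [hfun]
    rw [← ENNReal.ofReal_one]
    apply ENNReal.tendsto_ofReal
    have hδ : Tendsto (fun n : ℕ => ((r:ℝ) - 1) * (Real.log n / ((n:ℝ) - 1))) atTop (nhds 0) := by
      have := (hp_lim 1).const_mul ((r:ℝ) - 1)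
      simpa using this
    have hη : Tendsto (fun n : ℕ => 2 * (Real.log n *
        (((r:ℝ) - 1) * (Real.log n / ((n:ℝ) - 1))))) atTop (nhds 0) := by
      have := (hp_lim 2).const_mul (2 * ((r:ℝ) - 1))
      rw [mul_zero] at this
      refine this.congr (fun n => ?_)
      ring
    have hexp : Tendsto (fun n : ℕ => Real.exp (-g n + 2 * (Real.log n *
        (((r:ℝ) - 1) * (Real.log n / ((n:ℝ) - 1)))))) atTop (nhds 0) :=
      Real.tendsto_exp_atBot.comp ((tendsto_neg_atTop_atBot.comp hg1).atBot_add hη)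
    have hinv : Tendsto (fun n : ℕ => 1 / (1 - ((r:ℝ) - 1) * (Real.log n / ((n:ℝ) - 1))))
        atTop (nhds 1) := by
      have h1 : Tendsto (fun n : ℕ => 1 - ((r:ℝ) - 1) * (Real.log n / ((n:ℝ) - 1)))
          atTop (nhds 1) := by
        simpa using tendsto_const_nhds.sub hδ
      have := h1.inv₀ one_ne_zero
      simpa using this
    have hl := (tendsto_const_nhds (x := (2:ℝ)).sub hexp).sub hinv
    have he : (2:ℝ) - 0 - 1 = 1 := by norm_num
    rw [he] at hl
    refine tendsto_of_tendsto_of_tendsto_of_le_of_le' hl tendsto_const_nhds ?_ ?_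
    · filter_upwards [hle, eventually_ge_atTop r, hg1.eventually_ge_atTop 0,
        hδ.eventually_le_const (by norm_num : (0:ℝ) < 1 / 2)] with n h1 h2 h3 h4
      exact hp_a_bound hr h2 F g (π n) (hπ n) h1 h3 _ rfl h4
    · exact Eventually.of_forall (fun n => hp_P_le_one F n (π n) (hπ n))
  · intro π hπ hle μ hμ
    have hfun : ∀ n, (μ n).toOuterMeasure {H | ∃ v : Fin n, ∀ h ∈ H, v ∉ h.1} =
        ENNReal.ofReal (hpP F n (π n)) := fun n => hp_prob F n (π n) (hπ n) (μ n) (hμ n)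
    simp_rw [hfun]
    rw [← ENNReal.ofReal_zero]
    apply ENNReal.tendsto_ofReal
    have hexp : Tendsto (fun n : ℕ => Real.exp (-g n)) atTop (nhds 0) :=
      Real.tendsto_exp_atBot.comp (tendsto_neg_atTop_atBot.comp hg1)
    refine tendsto_of_tendsto_of_tendsto_of_le_of_le' tendsto_const_nhds hexp ?_ ?_
    · exact Eventually.of_forall (fun n => hp_P_nonneg F n (π n) (hπ n))
    · filter_upwards [hle, eventually_ge_atTop r] with n h1 h2
      exact hp_b_bound hr h2 F g (π n) (hπ n) h1
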